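/- arXiv:2107.04441 — 4 statements merged into one kernel-verified Lean document; each statement's English description precedes it below -/
import Mathlib

section
/- The principal Kolmogorov operator K is left invariant with respect to the group law ∘: for every ζ ∈ ℝ^{N+1} and every smooth function u : ℝ^{N+1} → ℝ, one has K(u ∘ ℓ_ζ)(z) = (Ku)(ζ∘z) for all z ∈ ℝ^{N+1}, where ℓ_ζ(z) = ζ∘z. -/
open MeasureTheory

noncomputable section

abbrev KSpace (N : ℕ) : Type := (Fin N → ℝ) × ℝ

/-- `E(s) = exp(-s B)`, defined by the exponential power series. -/
noncomputable def Emat {N : ℕ} (B : Matrix (Fin N) (Fin N) ℝ) (s : ℝ) :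
    Matrix (Fin N) (Fin N) ℝ :=
  ∑' n : ℕ, ((n.factorial : ℝ)⁻¹) • ((-s) • B) ^ n

/-- The group law `(x,t)∘(ξ,τ) = (ξ + E(τ)x, t+τ)`; `grpMul B z w = z ∘ w`. -/
def grpMul {N : ℕ} (B : Matrix (Fin N) (Fin N) ℝ) (z w : KSpace N) : KSpace N :=
  (w.1 + (Emat B w.2).mulVec z.1, z.2 + w.2)

/-- The candidate inverse `(x,t)⁻¹ = (-E(-t)x, -t)`. -/
def grpInv {N : ℕ} (B : Matrix (Fin N) (Fin N) ℝ) (z : KSpace N) : KSpace N :=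
  (-(Emat B (-z.2)).mulVec z.1, -z.2)

/-- Partial sums of block sizes: `offsetSum m j = m 0 + ⋯ + m (j-1)`. -/
def offsetSum (m : ℕ → ℕ) (j : ℕ) : ℕ := ∑ l ∈ Finset.range j, m l

/-- Index of the block containing coordinate `i`. -/
def blkIdx (κ : ℕ) (m : ℕ → ℕ) (i : ℕ) : ℕ :=
  Nat.findGreatest (fun j => offsetSum m j ≤ i) κ

/-- The dilation exponent of coordinate `i`: `α_i = 2j+1` when `i` lies in block `j`. -/
def alphaExp (κ : ℕ) (m : ℕ → ℕ) (i : ℕ) : ℕ := 2 * blkIdx κ m i + 1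

/-- The spatial homogeneous dimension `Q = m₀ + 3 m₁ + ⋯ + (2κ+1) m_κ`. -/
def homDim (κ : ℕ) (m : ℕ → ℕ) : ℕ := ∑ j ∈ Finset.range (κ + 1), (2 * j + 1) * m j

/-- `B` is in canonical form with blocks `m 0 ≥ m 1 ≥ … ≥ m κ ≥ 1` summing to `N`:
its only nonzero entries lie in blocks `B_j` (of size `m j × m (j-1)`) just below
the diagonal blocks, and each such block has rank `m j`. -/
def IsCanonical (N κ : ℕ) (m : ℕ → ℕ) (B : Matrix (Fin N) (Fin N) ℝ) : Prop :=
  (∀ j, j ≤ κ → 1 ≤ m j) ∧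
  (∀ j, j < κ → m (j + 1) ≤ m j) ∧
  (∑ j ∈ Finset.range (κ + 1), m j = N) ∧
  (∀ i i' : Fin N, B i i' ≠ 0 → blkIdx κ m (i : ℕ) = blkIdx κ m (i' : ℕ) + 1) ∧
  (∀ j, 1 ≤ j → j ≤ κ →
    (Matrix.of fun a b : Fin N =>
        if blkIdx κ m (a : ℕ) = j ∧ blkIdx κ m (b : ℕ) = j - 1 then B a b else 0).rank = m j)

/-- The dilation `δ_r` acting on `ℝ^{N+1}`. -/
def dil {N : ℕ} (κ : ℕ) (m : ℕ → ℕ) (r : ℝ) (z : KSpace N) : KSpace N :=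
  (fun i => r ^ alphaExp κ m (i : ℕ) * z.1 i, r ^ 2 * z.2)

/-- The unit cylinder `Q₁ = B₁ × ⋯ × B₁ × (-1,0)`, one Euclidean unit ball per block. -/
def unitCyl (N κ : ℕ) (m : ℕ → ℕ) : Set (KSpace N) :=
  {z | (∀ j, j ≤ κ → (∑ i : Fin N, if blkIdx κ m (i : ℕ) = j then z.1 i ^ 2 else 0) < 1) ∧
    z.2 ∈ Set.Ioo (-1 : ℝ) 0}

/-- The cylinder `Q_r(z₀) = z₀ ∘ δ_r(Q₁)`. -/
def cyl {N : ℕ} (B : Matrix (Fin N) (Fin N) ℝ) (κ : ℕ) (m : ℕ → ℕ) (r : ℝ) (z₀ : KSpace N) :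
    Set (KSpace N) :=
  (fun w => grpMul B z₀ (dil κ m r w)) '' unitCyl N κ m

/-- The delayed cylinder `Q̄_r^m(z₀) = ((0,…,0,m r²) ∘ Q_r(z₀)) ∩ (ℝ^N × (t₀,∞))`. -/
def delayedCyl {N : ℕ} (B : Matrix (Fin N) (Fin N) ℝ) (κ : ℕ) (m : ℕ → ℕ) (mm : ℕ) (r : ℝ)
    (z₀ : KSpace N) : Set (KSpace N) :=
  ((fun w => grpMul B ((0 : Fin N → ℝ), (mm : ℝ) * r ^ 2) w) '' cyl B κ m r z₀) ∩
    {z : KSpace N | z₀.2 < z.2}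

/-- The stacked cylinder `kQ_r(z₀) = (0,…,0,(k²-1)r²/2) ∘ Q_{kr}(z₀)`. -/
def stackedCyl {N : ℕ} (B : Matrix (Fin N) (Fin N) ℝ) (κ : ℕ) (m : ℕ → ℕ) (k : ℕ) (r : ℝ)
    (z₀ : KSpace N) : Set (KSpace N) :=
  (fun w => grpMul B ((0 : Fin N → ℝ), (((k : ℝ) ^ 2 - 1) / 2) * r ^ 2) w) ''
    cyl B κ m ((k : ℝ) * r) z₀

/-- The `i`-th spatial unit direction in `ℝ^{N+1}`. -/
def eSpat (N : ℕ) (i : Fin N) : KSpace N := (Pi.single i 1, 0)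

/-- The time direction in `ℝ^{N+1}`. -/
def eTime (N : ℕ) : KSpace N := (0, 1)

/-- The principal Kolmogorov operator
`K u = Σ_{i<m₀} ∂²_{x_i} u + ⟨Bx, Du⟩ - ∂_t u`. -/
def Kop {N : ℕ} (m₀ : ℕ) (B : Matrix (Fin N) (Fin N) ℝ) (u : KSpace N → ℝ) (z : KSpace N) : ℝ :=
  (∑ i : Fin N, if (i : ℕ) < m₀ then
      fderiv ℝ (fun w => fderiv ℝ u w (eSpat N i)) z (eSpat N i) else 0)
    + (∑ i : Fin N, B.mulVec z.1 i * fderiv ℝ u z (eSpat N i))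
    - fderiv ℝ u z (eTime N)

/-- The drift operator `Y u = ⟨Bx, Du⟩ - ∂_t u`. -/
def Yop {N : ℕ} (B : Matrix (Fin N) (Fin N) ℝ) (u : KSpace N → ℝ) (z : KSpace N) : ℝ :=
  (∑ i : Fin N, B.mulVec z.1 i * fderiv ℝ u z (eSpat N i)) - fderiv ℝ u z (eTime N)

/-- The matrix `A₀` with identity top-left `m₀ × m₀` block and zeros elsewhere. -/
def A0mat (N m₀ : ℕ) : Matrix (Fin N) (Fin N) ℝ :=
  Matrix.of fun i j : Fin N => if (i : ℕ) < m₀ ∧ i = j then 1 else 0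

/-- `C(t) = ∫₀ᵗ E(s) A₀ E(s)ᵀ ds`, entrywise. -/
def Cmat {N : ℕ} (B : Matrix (Fin N) (Fin N) ℝ) (m₀ : ℕ) (t : ℝ) : Matrix (Fin N) (Fin N) ℝ :=
  Matrix.of fun i j : Fin N => ∫ s in (0:ℝ)..t, (Emat B s * A0mat N m₀ * (Emat B s).transpose) i j

/-- The fundamental solution `Γ((x,t),(0,0))`. -/
def fundSol {N : ℕ} (B : Matrix (Fin N) (Fin N) ℝ) (m₀ : ℕ) (z : KSpace N) : ℝ :=
  if 0 < z.2 then
    (4 * Real.pi) ^ (-(N : ℝ) / 2) * (Cmat B m₀ z.2).det ^ (-(1 : ℝ) / 2) *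
      Real.exp (-(1/4) * (∑ i : Fin N, ((Cmat B m₀ z.2)⁻¹).mulVec z.1 i * z.1 i)
        - z.2 * B.trace)
  else 0

/-- The two-point fundamental solution `Γ(z,ζ) = Γ(ζ⁻¹ ∘ z, 0)`. -/
def fundSol2 {N : ℕ} (B : Matrix (Fin N) (Fin N) ℝ) (m₀ : ℕ) (z ζ : KSpace N) : ℝ :=
  fundSol B m₀ (grpMul B (grpInv B ζ) z)

/-- The homogeneous norm: `‖z‖` is the unique `r > 0` with
`Σ_i x_i²/r^{2α_i} + t²/r⁴ = 1` (and `‖0‖ = 0`); realized as an infimum. -/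
def homNorm {N : ℕ} (κ : ℕ) (m : ℕ → ℕ) (z : KSpace N) : ℝ :=
  sInf {r : ℝ | 0 < r ∧
    (∑ i : Fin N, z.1 i ^ 2 / r ^ (2 * alphaExp κ m (i : ℕ))) + z.2 ^ 2 / r ^ 4 = 1}

end

section

attribute [local instance] Matrix.linftyOpNormedRing Matrix.linftyOpNormedAlgebra

lemma Emat_eq_exp {N : ℕ} (B : Matrix (Fin N) (Fin N) ℝ) (s : ℝ) :
    Emat B s = NormedSpace.exp (s • (-B)) := by
  rw [NormedSpace.exp_eq_tsum ℝ, Emat]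
  simp only [neg_smul, smul_neg]

lemma hasDerivAt_Emat_mulVec {N : ℕ} (B : Matrix (Fin N) (Fin N) ℝ) (x : Fin N → ℝ) (s : ℝ) :
    HasDerivAt (fun s => (Emat B s).mulVec x) (-(B.mulVec ((Emat B s).mulVec x))) s := by
  simp only [Emat_eq_exp]
  have h := hasDerivAt_exp_smul_const' (𝕂 := ℝ) (-B) s
  let L : Matrix (Fin N) (Fin N) ℝ →ₗ[ℝ] (Fin N → ℝ) :=
    (Matrix.mulVecBilin ℝ ℝ).flip x
  have h' := (LinearMap.toContinuousLinearMap L).hasFDerivAt.comp_hasDerivAt s h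
  have hL : L (-B * NormedSpace.exp (s • -B)) =
      -(B.mulVec ((NormedSpace.exp (s • -B)).mulVec x)) := by
    simp [L]
  exact hL ▸ h'

end

/-- The derivative of the left translation by `ζ` at a point with time coordinate `w.2`. -/
noncomputable def grpMulDeriv {N : ℕ} (B : Matrix (Fin N) (Fin N) ℝ) (ζ w : KSpace N) :
    KSpace N →L[ℝ] KSpace N :=
  (ContinuousLinearMap.fst ℝ (Fin N → ℝ) ℝ +
    (ContinuousLinearMap.snd ℝ (Fin N → ℝ) ℝ).smulRight
      (-(B.mulVec ((Emat B w.2).mulVec ζ.1)))).prod (ContinuousLinearMap.snd ℝ (Fin N → ℝ) ℝ)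

lemma hasFDerivAt_grpMul {N : ℕ} (B : Matrix (Fin N) (Fin N) ℝ) (ζ w : KSpace N) :
    HasFDerivAt (grpMul B ζ) (grpMulDeriv B ζ w) w := by
  have h := (hasDerivAt_Emat_mulVec B ζ.1 w.2).hasFDerivAt.comp w
    (hasFDerivAt_snd (𝕜 := ℝ) (p := w))
  have h' := (hasFDerivAt_fst.add h).prodMk ((hasFDerivAt_snd (𝕜 := ℝ) (p := w)).const_add ζ.2)
  exact h'.congr_fderiv (by ext <;> simp [grpMulDeriv])

lemma grpMulDeriv_eSpat {N : ℕ} (B : Matrix (Fin N) (Fin N) ℝ) (ζ w : KSpace N) (i : Fin N) :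
    grpMulDeriv B ζ w (eSpat N i) = eSpat N i := by
  simp [grpMulDeriv, eSpat]

lemma grpMulDeriv_eTime {N : ℕ} (B : Matrix (Fin N) (Fin N) ℝ) (ζ w : KSpace N) :
    grpMulDeriv B ζ w (eTime N) =
      eTime N - ∑ i, B.mulVec ((Emat B w.2).mulVec ζ.1) i • eSpat N i := by
  ext j <;> simp [grpMulDeriv, eTime, eSpat, Prod.fst_sum, Prod.snd_sum, Finset.sum_apply,
    Pi.single_apply]

lemma fderiv_comp_grpMul {N : ℕ} (B : Matrix (Fin N) (Fin N) ℝ) (ζ : KSpace N)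
    {v : KSpace N → ℝ} (hv : Differentiable ℝ v) (w e : KSpace N) :
    fderiv ℝ (fun w => v (grpMul B ζ w)) w e =
      fderiv ℝ v (grpMul B ζ w) (grpMulDeriv B ζ w e) := by
  have h := (hv (grpMul B ζ w)).hasFDerivAt.comp w (hasFDerivAt_grpMul B ζ w)
  exact congrArg (fun L => L e) h.fderiv

/-- The principal Kolmogorov operator `K` is left invariant with respect to the
group law `∘`: for every `ζ` and every smooth `u`, `K(u ∘ ℓ_ζ)(z) = (Ku)(ζ∘z)` for all `z`. -/
theorem kolmogorov_left_invariant (N m₀ : ℕ) (hN : 1 ≤ N) (hm₀ : 1 ≤ m₀) (hm₀N : m₀ ≤ N)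
    (B : Matrix (Fin N) (Fin N) ℝ) (ζ : KSpace N) (u : KSpace N → ℝ)
    (hu : ContDiff ℝ (⊤ : ℕ∞) u) (z : KSpace N) :
    Kop m₀ B (fun w => u (grpMul B ζ w)) z = Kop m₀ B u (grpMul B ζ z) := by
  have hd : Differentiable ℝ u := hu.differentiable (by simp)
  have hd' (e : KSpace N) : Differentiable ℝ (fun w => fderiv ℝ u w e) :=
    ((hu.fderiv_right (m := 1) (by norm_cast)).clm_apply contDiff_const).differentiable
      (by simp)
  have hspat : (grpMul B ζ z).1 = z.1 + (Emat B z.2).mulVec ζ.1 := rfl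
  simp only [Kop, fderiv_comp_grpMul B ζ hd, grpMulDeriv_eSpat,
    fderiv_comp_grpMul B ζ (hd' _), grpMulDeriv_eTime, map_sub, map_sum, map_smul, smul_eq_mul,
    hspat, Matrix.mulVec_add, Pi.add_apply, add_mul, Finset.sum_add_distrib]
  ring
end

section
/- If B is in canonical form, then the principal Kolmogorov operator K is homogeneous of degree 2 with respect to the dilations (δ_r)_{r>0}: for every smooth u : ℝ^{N+1} → ℝ and every r > 0, K(u ∘ δ_r)(z) = r² (Ku)(δ_r z) for all z ∈ ℝ^{N+1}. -/
open MeasureTheory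

/-- The dilation `δ_r` as a continuous linear map. -/
noncomputable def dilCLM (N κ : ℕ) (m : ℕ → ℕ) (r : ℝ) : KSpace N →L[ℝ] KSpace N :=
  LinearMap.toContinuousLinearMap
    { toFun := dil κ m r
      map_add' := fun z w => by
        ext <;> simp [dil, mul_add]
      map_smul' := fun c z => by
        ext <;> simp [dil, mul_left_comm] }

theorem dilCLM_apply {N : ℕ} (κ : ℕ) (m : ℕ → ℕ) (r : ℝ) (z : KSpace N) :
    dilCLM N κ m r z = dil κ m r z := rfl

theorem dil_eSpat {N : ℕ} (κ : ℕ) (m : ℕ → ℕ) (r : ℝ) (i : Fin N) :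
    dil κ m r (eSpat N i) = r ^ alphaExp κ m i • eSpat N i := by
  ext j
  · rcases eq_or_ne j i with rfl | h <;> simp_all [dil, eSpat]
  · simp [dil, eSpat]

theorem dil_eTime (N κ : ℕ) (m : ℕ → ℕ) (r : ℝ) :
    dil κ m r (eTime N) = r ^ 2 • eTime N := by
  ext <;> simp [dil, eTime]

theorem fderiv_comp_dil {N : ℕ} (κ : ℕ) (m : ℕ → ℕ) (r : ℝ) {u : KSpace N → ℝ}
    (hu : Differentiable ℝ u) (z v : KSpace N) :
    fderiv ℝ (fun w => u (dil κ m r w)) z v = fderiv ℝ u (dil κ m r z) (dil κ m r v) := by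
  have h := (hu (dilCLM N κ m r z)).hasFDerivAt.comp z (dilCLM N κ m r).hasFDerivAt
  exact congrArg (fun L => L v) h.fderiv

theorem blkIdx_eq_zero {κ : ℕ} {m : ℕ → ℕ} {i : ℕ} (hi : i < m 0) : blkIdx κ m i = 0 := by
  refine Nat.findGreatest_eq_zero_iff.2 fun j hj _ => ?_
  have h : m 0 ≤ offsetSum m j :=
    Finset.single_le_sum (f := m) (fun _ _ => Nat.zero_le _) (Finset.mem_range.2 hj)
  omega

/-- A matrix supported on the subdiagonal blocks lowers the dilation weight by two. -/
theorem pow_alphaExp_mul_mulVec {N κ : ℕ} {m : ℕ → ℕ} {B : Matrix (Fin N) (Fin N) ℝ}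
    (hB : ∀ i j : Fin N, B i j ≠ 0 → blkIdx κ m i = blkIdx κ m j + 1)
    (r : ℝ) (z : KSpace N) (i : Fin N) :
    r ^ alphaExp κ m i * B.mulVec z.1 i = r ^ 2 * B.mulVec (dil κ m r z).1 i := by
  simp only [Matrix.mulVec, dotProduct, Finset.mul_sum, dil]
  refine Finset.sum_congr rfl fun j _ => ?_
  by_cases h : B i j = 0
  · simp [h]
  · rw [show alphaExp κ m i = alphaExp κ m j + 2 by simp only [alphaExp, hB i j h]; ring]
    ring

/-- If `B` is in canonical form, the principal Kolmogorov operator `K` is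
homogeneous of degree `2` with respect to the dilations: for every smooth `u` and every `r > 0`,
`K(u ∘ δ_r)(z) = r² (Ku)(δ_r z)` for all `z`. -/
theorem kolmogorov_dilation_homogeneous (N κ : ℕ) (m : ℕ → ℕ) (hN : 1 ≤ N)
    (B : Matrix (Fin N) (Fin N) ℝ) (hB : IsCanonical N κ m B)
    (u : KSpace N → ℝ) (hu : ContDiff ℝ (⊤ : ℕ∞) u) (r : ℝ) (hr : 0 < r) (z : KSpace N) :
    Kop (m 0) B (fun w => u (dil κ m r w)) z = r ^ 2 * Kop (m 0) B u (dil κ m r z) := by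
  have hd : Differentiable ℝ u := hu.differentiable (by simp)
  have hd2 (i : Fin N) : Differentiable ℝ fun w => fderiv ℝ u w (eSpat N i) :=
    ((hu.fderiv_right (m := 1) (by norm_cast)).differentiable one_ne_zero).clm_apply
      (differentiable_const _)
  have hspat (i : Fin N) (w : KSpace N) : fderiv ℝ (fun w => u (dil κ m r w)) w (eSpat N i) =
      r ^ alphaExp κ m i * fderiv ℝ u (dil κ m r w) (eSpat N i) := by
    rw [fderiv_comp_dil κ m r hd, dil_eSpat, map_smul, smul_eq_mul]
  have htime : fderiv ℝ (fun w => u (dil κ m r w)) z (eTime N) =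
      r ^ 2 * fderiv ℝ u (dil κ m r z) (eTime N) := by
    rw [fderiv_comp_dil κ m r hd, dil_eTime, map_smul, smul_eq_mul]
  simp only [Kop, htime, hspat, mul_sub, mul_add, Finset.mul_sum]
  congr 2 <;> refine Finset.sum_congr rfl fun i _ => ?_
  · split_ifs with hi
    · have hα : alphaExp κ m i = 1 := by simp [alphaExp, blkIdx_eq_zero hi]
      have hdd : DifferentiableAt ℝ (fun w => fderiv ℝ u (dil κ m r w) (eSpat N i)) z :=
        ((hd2 i).comp (dilCLM N κ m r).differentiable) z
      rw [fderiv_const_mul hdd, _root_.smul_apply, fderiv_comp_dil κ m r (hd2 i),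
        dil_eSpat, map_smul, hα, smul_eq_mul, smul_eq_mul]
      ring
    · simp
  · rw [← mul_assoc, ← mul_assoc, ← pow_alphaExp_mul_mulVec hB.2.2.2.1, mul_comm (B.mulVec z.1 i)]
end

section
/- There exists a constant c̄ ∈ (0,1) such that for every ρ, r with 0 < ρ < r ≤ 1 and every z ∈ Q_ρ, one has z ∘ Q_{c̄ r (r−ρ)} ⊆ Q_r, where z ∘ Q_s = { z∘ζ : ζ ∈ Q_s }. -/
open MeasureTheory

lemma sum_add_sq_lt {ι : Type*} (S : Finset ι) (x y : ι → ℝ) {a b : ℝ} (ha : 0 < a)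
    (hx : ∑ i ∈ S, x i ^ 2 < a ^ 2) (hy : ∑ i ∈ S, |y i| ≤ b) :
    ∑ i ∈ S, (x i + y i) ^ 2 < (a + b) ^ 2 := by
  have hxa : ∀ i ∈ S, |x i| ≤ a := fun i hi =>
    abs_le_of_sq_le_sq ((Finset.single_le_sum (f := fun i => x i ^ 2)
      (fun j _ => sq_nonneg _) hi).trans hx.le) ha.le
  have h0 : 0 ≤ ∑ i ∈ S, |y i| := Finset.sum_nonneg fun i _ => abs_nonneg _
  have h1 : ∑ i ∈ S, x i * y i ≤ a * ∑ i ∈ S, |y i| := by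
    rw [Finset.mul_sum]
    refine Finset.sum_le_sum fun i hi => (le_abs_self _).trans ?_
    rw [abs_mul]
    exact mul_le_mul_of_nonneg_right (hxa i hi) (abs_nonneg _)
  have h2 : ∑ i ∈ S, y i ^ 2 ≤ (∑ i ∈ S, |y i|) ^ 2 := by
    simpa using Finset.sum_sq_le_sq_sum_of_nonneg (s := S) (f := fun i => |y i|)
      (fun i _ => abs_nonneg (y i))
  have h3 : ∑ i ∈ S, (x i + y i) ^ 2
      = ∑ i ∈ S, x i ^ 2 + 2 * ∑ i ∈ S, x i * y i + ∑ i ∈ S, y i ^ 2 := by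
    rw [Finset.mul_sum, ← Finset.sum_add_distrib, ← Finset.sum_add_distrib]
    exact Finset.sum_congr rfl fun i _ => by ring
  have h4 : a * ∑ i ∈ S, |y i| ≤ a * b := mul_le_mul_of_nonneg_left hy ha.le
  have h5 : (∑ i ∈ S, |y i|) ^ 2 ≤ b ^ 2 := pow_le_pow_left₀ h0 hy 2
  nlinarith

lemma blkIdx_le (κ : ℕ) (m : ℕ → ℕ) (i : ℕ) : blkIdx κ m i ≤ κ := Nat.findGreatest_le κ

lemma IsCanonical.blkIdx_of_pow_ne_zero {N κ : ℕ} {m : ℕ → ℕ} {B : Matrix (Fin N) (Fin N) ℝ}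
    (hB : IsCanonical N κ m B) (n : ℕ) (i i' : Fin N) (h : (B ^ n) i i' ≠ 0) :
    blkIdx κ m i = blkIdx κ m i' + n := by
  induction n generalizing i with
  | zero =>
    rw [pow_zero, Matrix.one_apply] at h
    have : i = i' := by by_contra hne; simp [hne] at h
    rw [this, add_zero]
  | succ n ih =>
    rw [pow_succ', Matrix.mul_apply] at h
    obtain ⟨k, -, hk⟩ := Finset.exists_ne_zero_of_sum_ne_zero h
    have h1 := hB.2.2.2.1 i k (left_ne_zero_of_mul hk)
    have h2 := ih k (right_ne_zero_of_mul hk)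
    omega

lemma IsCanonical.pow_eq_zero {N κ : ℕ} {m : ℕ → ℕ} {B : Matrix (Fin N) (Fin N) ℝ}
    (hB : IsCanonical N κ m B) {n : ℕ} (hn : κ < n) : B ^ n = 0 := by
  ext i i'
  by_contra h
  have h1 := hB.blkIdx_of_pow_ne_zero n i i' h
  have h2 := blkIdx_le κ m i
  omega

lemma IsCanonical.Emat_mulVec {N κ : ℕ} {m : ℕ → ℕ} {B : Matrix (Fin N) (Fin N) ℝ}
    (hB : IsCanonical N κ m B) (s : ℝ) (x : Fin N → ℝ) (i : Fin N) :
    (Emat B s).mulVec x i = x i + ∑ n ∈ Finset.range κ, ∑ i' : Fin N,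
      (((n + 1).factorial : ℝ)⁻¹ * (-s) ^ (n + 1)) * ((B ^ (n + 1)) i i' * x i') := by
  have h : Emat B s = ∑ n ∈ Finset.range (κ + 1), ((n.factorial : ℝ)⁻¹) • ((-s) • B) ^ n := by
    refine tsum_eq_sum fun n hn => ?_
    rw [smul_pow, hB.pow_eq_zero (by simpa [Nat.lt_succ_iff] using hn), smul_zero, smul_zero]
  rw [h, Matrix.sum_mulVec, Finset.sum_range_succ', add_comm, Pi.add_apply, Finset.sum_apply]
  congr 1
  · simp
  · refine Finset.sum_congr rfl fun n _ => ?_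
    rw [smul_pow, smul_smul, Matrix.smul_mulVec, Pi.smul_apply, Matrix.mulVec, dotProduct,
      smul_eq_mul, Finset.mul_sum]

lemma mem_cyl_zero_iff {N κ : ℕ} {m : ℕ → ℕ} (B : Matrix (Fin N) (Fin N) ℝ) {r : ℝ} (hr : 0 < r)
    (z : KSpace N) :
    z ∈ cyl B κ m r ((0 : Fin N → ℝ), (0 : ℝ)) ↔
      (∀ j, j ≤ κ → ∑ i with blkIdx κ m (i : Fin N) = j, z.1 i ^ 2 < (r ^ (2 * j + 1)) ^ 2) ∧
        z.2 ∈ Set.Ioo (-r ^ 2) 0 := by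
  have hdil : ∀ w : KSpace N, grpMul B ((0 : Fin N → ℝ), (0 : ℝ)) (dil κ m r w) = dil κ m r w := by
    intro w
    ext <;> simp [grpMul]
  have hr2 : 0 < r ^ 2 := by positivity
  have key : ∀ w : KSpace N, w ∈ unitCyl N κ m ↔
      (∀ j, j ≤ κ → ∑ i with blkIdx κ m (i : Fin N) = j, (dil κ m r w).1 i ^ 2
        < (r ^ (2 * j + 1)) ^ 2) ∧ (dil κ m r w).2 ∈ Set.Ioo (-r ^ 2) 0 := by
    intro w
    refine and_congr (forall₂_congr fun j _ => ?_) ?_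
    · have : ∑ i with blkIdx κ m (i : Fin N) = j, (dil κ m r w).1 i ^ 2
          = (r ^ (2 * j + 1)) ^ 2 * ∑ i with blkIdx κ m (i : Fin N) = j, w.1 i ^ 2 := by
        rw [Finset.mul_sum]
        refine Finset.sum_congr rfl fun i hi => ?_
        simp only [Finset.mem_filter] at hi
        simp only [dil, alphaExp, hi.2]
        ring
      rw [this, ← Finset.sum_filter]
      exact (mul_lt_iff_lt_one_right (by positivity)).symm
    · simp only [dil, Set.mem_Ioo]
      constructor
      · rintro ⟨h1, h2⟩
        constructor <;> nlinarith
      · rintro ⟨h1, h2⟩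
        constructor <;> nlinarith
  constructor
  · rintro ⟨w, hw, rfl⟩
    simp only [hdil]
    exact (key w).1 hw
  · intro hz
    have hw : dil κ m r (fun i => z.1 i / r ^ alphaExp κ m i, z.2 / r ^ 2) = z := by
      ext <;> simp only [dil] <;> field_simp
    refine ⟨_, (key _).2 ?_, (hdil _).trans hw⟩
    rwa [hw]

lemma abs_lt_of_block_sum_lt {N κ : ℕ} {m : ℕ → ℕ} {x : Fin N → ℝ} {r : ℝ} (hr : 0 < r)
    (h : ∀ j, j ≤ κ → ∑ i with blkIdx κ m (i : Fin N) = j, x i ^ 2 < (r ^ (2 * j + 1)) ^ 2)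
    (i : Fin N) : |x i| < r ^ (2 * blkIdx κ m i + 1) := by
  refine abs_lt_of_sq_lt_sq (lt_of_le_of_lt ?_ (h _ (blkIdx_le κ m i))) (by positivity)
  exact Finset.single_le_sum (f := fun i => x i ^ 2) (fun j _ => sq_nonneg _) (by simp)

lemma pow_add_mul_sub_le {ρ r : ℝ} (hρ : 0 < ρ) (h : ρ < r) (hr : r ≤ 1) (j : ℕ) :
    ρ ^ (j + 1) + r ^ (j + 1) * (r - ρ) ≤ r ^ (j + 1) := by
  have h1 : ρ ^ j ≤ r ^ j := pow_le_pow_left₀ hρ.le h.le j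
  have h2 : 0 < r ^ j := pow_pos (hρ.trans h) j
  have h3 : r ^ j * r * (r - ρ) ≤ r ^ j * (r - ρ) :=
    mul_le_mul_of_nonneg_right (mul_le_of_le_one_right h2.le hr) (by linarith)
  have h4 := mul_le_mul_of_nonneg_right h1 hρ.le
  rw [pow_succ, pow_succ]
  nlinarith

lemma mul_mul_sub_pow_le {c ρ r : ℝ} (hc : 0 < c) (hc1 : c < 1) (hρ : 0 < ρ) (h : ρ < r)
    (hr : r ≤ 1) (k : ℕ) :
    (c * r * (r - ρ)) ^ (k + 1) ≤ c * (r ^ (k + 1) * (r - ρ)) := by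
  have hd : 0 ≤ r - ρ := by linarith
  have h1 : c ^ (k + 1) ≤ c := pow_le_of_le_one hc.le hc1.le (by omega)
  have h2 : (r - ρ) ^ (k + 1) ≤ r - ρ := pow_le_of_le_one hd (by linarith) (by omega)
  have h3 : 0 ≤ r ^ (k + 1) := pow_nonneg (hρ.trans h).le _
  rw [mul_pow, mul_pow, mul_assoc]
  gcongr

/-- There exists `c̄ ∈ (0,1)` such that for every `0 < ρ < r ≤ 1` and every
`z ∈ Q_ρ`, one has `z ∘ Q_{c̄ r (r-ρ)} ⊆ Q_r` (note `z ∘ Q_s = Q_s(z)`). -/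
theorem cylinder_inclusion (N κ : ℕ) (m : ℕ → ℕ) (hN : 1 ≤ N)
    (B : Matrix (Fin N) (Fin N) ℝ) (hB : IsCanonical N κ m B) :
    ∃ cbar : ℝ, cbar ∈ Set.Ioo (0 : ℝ) 1 ∧
      ∀ ρ r : ℝ, 0 < ρ → ρ < r → r ≤ 1 →
        ∀ z ∈ cyl B κ m ρ ((0 : Fin N → ℝ), (0 : ℝ)),
          cyl B κ m (cbar * r * (r - ρ)) z ⊆ cyl B κ m r ((0 : Fin N → ℝ), (0 : ℝ)) := by
  obtain ⟨C, hCdef⟩ : ∃ C : ℝ, C = ∑ i : Fin N, ∑ n ∈ Finset.range κ, ∑ i' : Fin N,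
      |(B ^ (n + 1)) i i'| := ⟨_, rfl⟩
  have hC : 0 ≤ C := hCdef ▸ Finset.sum_nonneg fun _ _ => Finset.sum_nonneg fun _ _ =>
    Finset.sum_nonneg fun _ _ => abs_nonneg _
  have hN' : (1 : ℝ) ≤ N := by exact_mod_cast hN
  obtain ⟨c, hcdef⟩ : ∃ c : ℝ, c = (N + C + 1)⁻¹ := ⟨_, rfl⟩
  have hc : 0 < c := by rw [hcdef]; positivity
  have hc1 : c < 1 := by rw [hcdef]; exact inv_lt_one_of_one_lt₀ (by linarith)
  have hcC : (N + C) * c ≤ 1 := by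
    rw [hcdef, ← div_eq_mul_inv, div_le_one (by positivity)]
    linarith
  refine ⟨c, ⟨hc, hc1⟩, fun ρ r hρ hρr hr z hz => ?_⟩
  have hr0 : 0 < r := hρ.trans hρr
  have hd : 0 < r - ρ := by linarith
  have hσ : 0 < c * r * (r - ρ) := by positivity
  rintro _ ⟨w, hw, rfl⟩
  rw [mem_cyl_zero_iff B hρ] at hz
  obtain ⟨hzx, hzt⟩ := hz
  have hw' : dil κ m (c * r * (r - ρ)) w ∈
      cyl B κ m (c * r * (r - ρ)) ((0 : Fin N → ℝ), (0 : ℝ)) :=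
    ⟨w, hw, by ext <;> simp [grpMul]⟩
  rw [mem_cyl_zero_iff B hσ] at hw'
  change grpMul B z (dil κ m (c * r * (r - ρ)) w) ∈ _
  generalize dil κ m (c * r * (r - ρ)) w = ζ at hw' ⊢
  obtain ⟨hζx, hζt⟩ := hw'
  have hσ2 := mul_mul_sub_pow_le hc hc1 hρ hρr hr
  rw [mem_cyl_zero_iff B hr0]
  constructor
  · intro j hj
    let y : Fin N → ℝ := fun i => ζ.1 i + ∑ n ∈ Finset.range κ, ∑ i' : Fin N,
      (((n + 1).factorial : ℝ)⁻¹ * (-ζ.2) ^ (n + 1)) * ((B ^ (n + 1)) i i' * z.1 i')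
    have hy : ∀ i, (grpMul B z ζ).1 i = z.1 i + y i := by
      intro i
      simp only [grpMul, Pi.add_apply, hB.Emat_mulVec, y]
      ring
    have hterm : ∀ (i i' : Fin N) (n : ℕ),
        |(((n + 1).factorial : ℝ)⁻¹ * (-ζ.2) ^ (n + 1)) * ((B ^ (n + 1)) i i' * z.1 i')|
          ≤ |(B ^ (n + 1)) i i'| * (c * (r ^ (2 * blkIdx κ m i + 1) * (r - ρ))) := by
      intro i i' n
      rcases eq_or_ne ((B ^ (n + 1)) i i') 0 with h0 | h0
      · simp [h0]
      have hblk := hB.blkIdx_of_pow_ne_zero _ _ _ h0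
      have hf : |((n + 1).factorial : ℝ)⁻¹| ≤ 1 := by
        rw [abs_of_nonneg (by positivity)]
        exact inv_le_one_of_one_le₀ (by exact_mod_cast Nat.factorial_pos _)
      have ht : |(-ζ.2) ^ (n + 1)| ≤ c * (r ^ (2 * n + 1 + 1) * (r - ρ)) := by
        rw [abs_pow, abs_neg, abs_of_neg hζt.2]
        refine le_trans (pow_le_pow_left₀ (by linarith [hζt.2])
          (show -ζ.2 ≤ (c * r * (r - ρ)) ^ 2 by linarith [hζt.1]) _) ?_
        rw [← pow_mul, show 2 * (n + 1) = 2 * n + 1 + 1 by ring]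
        exact hσ2 _
      have hz' : |z.1 i'| ≤ r ^ (2 * blkIdx κ m i' + 1) :=
        (abs_lt_of_block_sum_lt hρ hzx i').le.trans (pow_le_pow_left₀ hρ.le hρr.le _)
      rw [abs_mul, abs_mul, abs_mul]
      calc _ ≤ (1 * (c * (r ^ (2 * n + 1 + 1) * (r - ρ)))) *
            (|(B ^ (n + 1)) i i'| * r ^ (2 * blkIdx κ m i' + 1)) := by gcongr
        _ = _ := by rw [hblk]; ring
    have hyi : ∀ i, |y i| ≤ (1 + ∑ n ∈ Finset.range κ, ∑ i' : Fin N, |(B ^ (n + 1)) i i'|) *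
        (c * (r ^ (2 * blkIdx κ m i + 1) * (r - ρ))) := by
      intro i
      refine (abs_add_le _ _).trans ?_
      rw [add_mul, one_mul]
      refine add_le_add ((abs_lt_of_block_sum_lt hσ hζx i).le.trans (hσ2 _)) ?_
      rw [Finset.sum_mul]
      refine (Finset.abs_sum_le_sum_abs _ _).trans (Finset.sum_le_sum fun n _ => ?_)
      rw [Finset.sum_mul]
      exact (Finset.abs_sum_le_sum_abs _ _).trans (Finset.sum_le_sum fun i' _ => hterm i i' n)
    have hsum : ∑ i with blkIdx κ m (i : Fin N) = j, |y i| ≤ r ^ (2 * j + 1) * (r - ρ) := by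
      have hpos : 0 ≤ r ^ (2 * j + 1) * (r - ρ) := by positivity
      calc ∑ i with blkIdx κ m (i : Fin N) = j, |y i|
          ≤ ∑ i with blkIdx κ m (i : Fin N) = j,
            (1 + ∑ n ∈ Finset.range κ, ∑ i' : Fin N, |(B ^ (n + 1)) i i'|) *
              (c * (r ^ (2 * j + 1) * (r - ρ))) := by
            refine Finset.sum_le_sum fun i hi => (hyi i).trans_eq ?_
            rw [(Finset.mem_filter.1 hi).2]
        _ ≤ ∑ i : Fin N, (1 + ∑ n ∈ Finset.range κ, ∑ i' : Fin N, |(B ^ (n + 1)) i i'|) *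
              (c * (r ^ (2 * j + 1) * (r - ρ))) :=
            Finset.sum_le_sum_of_subset_of_nonneg (Finset.filter_subset _ _)
              fun i _ _ => by positivity
        _ = (N + C) * c * (r ^ (2 * j + 1) * (r - ρ)) := by
            rw [← Finset.sum_mul, Finset.sum_add_distrib, ← hCdef]
            simp [mul_assoc]
        _ ≤ r ^ (2 * j + 1) * (r - ρ) := mul_le_of_le_one_left hpos hcC
    simp only [hy]
    refine (sum_add_sq_lt _ _ _ (pow_pos hρ _) (hzx j hj) hsum).trans_le ?_
    exact pow_le_pow_left₀ (by positivity) (pow_add_mul_sub_le hρ hρr hr _) 2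
  · have h1 := pow_add_mul_sub_le hρ hρr hr 1
    have h2 : (c * r * (r - ρ)) ^ 2 ≤ r ^ 2 * (r - ρ) :=
      (hσ2 1).trans (mul_le_of_le_one_left (by positivity) hc1.le)
    norm_num at h1
    simp only [grpMul, Set.mem_Ioo]
    constructor
    · linarith [hzt.1, hζt.1]
    · linarith [hzt.2, hζt.2]
end

section
/- Let m > 0 and let (a_k)_k and (h_k)_k be (possibly infinite) sequences of real numbers with h_k > 0. Then the one-dimensional Lebesgue measures of the unions of the shifted intervals satisfy |⋃_k (a_k, a_k + m h_k]| ≥ (m/(m+1)) |⋃_k (a_k − h_k, a_k]|. -/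
open MeasureTheory

/-- A connected set of finite measure in `ℝ` lies in an interval whose length is at most its
measure. -/
theorem exists_subset_Icc_of_isConnected {C : Set ℝ} (hC : IsConnected C)
    (hfin : volume C ≠ ⊤) :
    ∃ c d : ℝ, C ⊆ Set.Icc c d ∧ ENNReal.ofReal (d - c) ≤ volume C := by
  have hlen : ∀ x ∈ C, ∀ y ∈ C, y - x ≤ (volume C).toReal := fun x hx y hy => by
    rw [← ENNReal.ofReal_le_iff_le_toReal hfin, ← Real.volume_Icc]
    exact measure_mono (hC.isPreconnected.Icc_subset hx hy)
  obtain ⟨x, hx⟩ := hC.nonempty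
  have hbelow : BddBelow C :=
    ⟨x - (volume C).toReal, fun y hy => by linarith [hlen y hy x hx]⟩
  have habove : BddAbove C :=
    ⟨x + (volume C).toReal, fun y hy => by linarith [hlen x hx y hy]⟩
  refine ⟨sInf C, sSup C, fun y hy => ⟨csInf_le hbelow hy, le_csSup habove hy⟩, ?_⟩
  rw [← Real.volume_Ioo]
  exact measure_mono (hC.Ioo_csInf_csSup_subset hbelow habove)

/-- If the intervals `(a_k, a_k + m h_k]` all lie in one connected set `C`, then the
union of the intervals `(a_k - h_k, a_k]` has measure at most `(m + 1) / m` times that of `C`. -/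
theorem volume_iUnion_Ioc_le_of_isConnected {κ : Type*} {m : ℝ} (hm : 0 < m) {a h : κ → ℝ}
    (hh : ∀ k, 0 < h k) {C : Set ℝ} (hC : IsConnected C)
    (hsub : ∀ k, Set.Ioc (a k) (a k + m * h k) ⊆ C) :
    ENNReal.ofReal (m / (m + 1)) * volume (⋃ k, Set.Ioc (a k - h k) (a k)) ≤ volume C := by
  by_cases hfin : volume C = ⊤
  · simp [hfin]
  obtain ⟨c, d, hcd, hvol⟩ := exists_subset_Icc_of_isConnected hC hfin
  have hunion : (⋃ k, Set.Ioc (a k - h k) (a k)) ⊆ Set.Icc (c - (d - c) / m) d := by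
    refine Set.iUnion_subset fun k => ?_
    have hk : a k < a k + m * h k := lt_add_of_pos_right _ (mul_pos hm (hh k))
    have hIcc : Set.Icc (a k) (a k + m * h k) ⊆ Set.Icc c d := by
      rw [← closure_Ioc hk.ne]
      exact closure_minimal ((hsub k).trans hcd) isClosed_Icc
    obtain ⟨hca, hd⟩ := (Set.Icc_subset_Icc_iff hk.le).1 hIcc
    have hle : h k ≤ (d - c) / m - (a k - c) / m := by
      rw [← sub_div, le_div_iff₀ hm]
      linarith
    have hnonneg : 0 ≤ (a k - c) / m := div_nonneg (sub_nonneg.2 hca) hm.le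
    exact fun x hx => ⟨by linarith [hx.1], by linarith [hx.2]⟩
  calc ENNReal.ofReal (m / (m + 1)) * volume (⋃ k, Set.Ioc (a k - h k) (a k))
      ≤ ENNReal.ofReal (m / (m + 1)) * volume (Set.Icc (c - (d - c) / m) d) := by
        gcongr
    _ = ENNReal.ofReal (d - c) := by
        rw [Real.volume_Icc, ← ENNReal.ofReal_mul (by positivity)]
        congr 1
        field_simp
        ring
    _ ≤ volume C := hvol

/-- For `m > 0` and countable families of intervals, the Lebesgue measures of
the unions of the shifted intervals satisfy
`|⋃_k (a_k, a_k + m h_k]| ≥ (m/(m+1)) |⋃_k (a_k - h_k, a_k]|`. -/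
theorem shifted_intervals_measure (ι : Type) [Countable ι] (mr : ℝ) (hm : 0 < mr)
    (a h : ι → ℝ) (hh : ∀ k, 0 < h k) :
    ENNReal.ofReal (mr / (mr + 1)) * volume (⋃ k, Set.Ioc (a k - h k) (a k)) ≤
      volume (⋃ k, Set.Ioc (a k) (a k + mr * h k)) := by
  set V := ⋃ k, Set.Ioc (a k) (a k + mr * h k)
  have hmem : ∀ k, a k + mr * h k ∈ Set.Ioc (a k) (a k + mr * h k) := fun k =>
    Set.right_mem_Ioc.2 (lt_add_of_pos_right _ (mul_pos hm (hh k)))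
  have hIV : ∀ k, Set.Ioc (a k) (a k + mr * h k) ⊆ V := Set.subset_iUnion _
  let comp : ι → Set ℝ := fun k => connectedComponentIn V (a k + mr * h k)
  have hsub : ∀ k, Set.Ioc (a k) (a k + mr * h k) ⊆ comp k := fun k =>
    isPreconnected_Ioc.subset_connectedComponentIn (hmem k) (hIV k)
  have hdisj : Pairwise (Function.onFun Disjoint fun C : Set.range comp => (C : Set ℝ)) := by
    rintro ⟨_, k, rfl⟩ ⟨_, l, rfl⟩ hne
    refine Set.disjoint_left.2 fun x hxk hxl => hne (Subtype.ext ?_)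
    exact (connectedComponentIn_eq hxk).trans (connectedComponentIn_eq hxl).symm
  have hmeas : ∀ C : Set.range comp, MeasurableSet (C : Set ℝ) := by
    rintro ⟨_, k, rfl⟩
    exact isPreconnected_connectedComponentIn.ordConnected.measurableSet
  have hcover : (⋃ k, Set.Ioc (a k - h k) (a k)) ⊆
      ⋃ C : Set.range comp, ⋃ k : {k // comp k = C}, Set.Ioc (a k - h k) (a k) :=
    Set.iUnion_subset fun k => Set.subset_iUnion_of_subset ⟨comp k, k, rfl⟩ <|
      Set.subset_iUnion_of_subset (⟨k, rfl⟩ : {l // comp l = comp k}) subset_rfl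
  have : Countable (Set.range comp) := (Set.countable_range comp).to_subtype
  calc ENNReal.ofReal (mr / (mr + 1)) * volume (⋃ k, Set.Ioc (a k - h k) (a k))
      ≤ ENNReal.ofReal (mr / (mr + 1)) * ∑' C : Set.range comp,
          volume (⋃ k : {k // comp k = C}, Set.Ioc (a k - h k) (a k)) := by
        gcongr
        exact (measure_mono hcover).trans (measure_iUnion_le _)
    _ ≤ ∑' C : Set.range comp, volume (C : Set ℝ) := by
        rw [← ENNReal.tsum_mul_left]
        refine ENNReal.tsum_le_tsum ?_
        rintro ⟨_, k, rfl⟩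
        exact volume_iUnion_Ioc_le_of_isConnected (κ := {l // comp l = comp k}) hm
          (fun l => hh l) ⟨⟨_, hsub k (hmem k)⟩, isPreconnected_connectedComponentIn⟩
          fun l => (hsub l).trans l.2.le
    _ = volume (⋃ C : Set.range comp, (C : Set ℝ)) := (measure_iUnion hdisj hmeas).symm
    _ ≤ volume V := by
        refine measure_mono (Set.iUnion_subset ?_)
        rintro ⟨_, k, rfl⟩
        exact connectedComponentIn_subset _ _
end
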